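/- (Identification via spatial differencing, Theorem 1.) Let p, k be natural numbers, let x_i, x_k ∈ ℝᵖ, z_i, z_k ∈ ℝᵏ, parameters δ ∈ ℝᵖ, β ∈ ℝᵏ, and real constants ρ, γ (common sub-location plus location outcome effect for both individuals) and θ (common sub-location plus location selection effect for both individuals). On a probability space (Ω, F, P), let ε₁ᵢ, ε₁ₖ be standard normal random variables, vᵢ, vₖ integrable with mean zero, such that vᵢ is independent of ε₁ᵢ, vₖ is independent of ε₁ₖ, and the pair (ε₁ᵢ, vᵢ) is independent of the pair (ε₁ₖ, vₖ). Define outcomes y_i = ⟨x_i, δ⟩ + γ + ρ ε₁ᵢ + vᵢ and y_k = ⟨x_k, δ⟩ + γ + ρ ε₁ₖ + vₖ, and selection events Aᵢ = {ε₁ᵢ > −(⟨z_i, β⟩ + θ)} and Aₖ = {ε₁ₖ > −(⟨z_k, β⟩ + θ)}. Assume λ(⟨z_i, β⟩ + θ) − λ(⟨z_i, β⟩) = λ(⟨z_k, β⟩ + θ) − λ(⟨z_k, β⟩). Then E[y_i − y_k | Aᵢ ∩ Aₖ] = ⟨x_i − x_k, δ⟩ + ρ (λ(⟨z_i, β⟩)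 − λ(⟨z_k, β⟩)), so the spatially differenced conditional expectation depends only on observables and the parameters δ, ρ. -/

import Mathlib

open MeasureTheory ProbabilityTheory Real Set

/-- The standard normal density φ(x) = (2π)^{-1/2} exp(-x²/2). -/
noncomputable def stdNormalPDF (x : ℝ) : ℝ :=
  (Real.sqrt (2 * Real.pi))⁻¹ * Real.exp (-x ^ 2 / 2)

/-- The standard normal cumulative distribution function Φ(x) = ∫_{-∞}^{x} φ(t) dt. -/
noncomputable def stdNormalCDF (x : ℝ) : ℝ :=
  ∫ t in Set.Iic x, stdNormalPDF t

/-- The inverse Mills ratio λ(x) = φ(x)/Φ(x). -/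
noncomputable def invMills (x : ℝ) : ℝ := stdNormalPDF x / stdNormalCDF x

/-- The conditional expectation of `Y` given the event `A`:
`E[Y | A] = (1/P(A)) ∫_A Y dP`. -/
noncomputable def condExpEvent {Ω : Type*} [MeasurableSpace Ω] (P : Measure Ω)
    (Y : Ω → ℝ) (A : Set Ω) : ℝ :=
  (P A).toReal⁻¹ * ∫ ω in A, Y ω ∂P

open Filter Topology

lemma stdNormalPDF_eq_gaussianPDFReal : stdNormalPDF = gaussianPDFReal 0 1 := by
  ext x
  simp [stdNormalPDF, gaussianPDFReal]

lemma stdNormalPDF_neg (x : ℝ) : stdNormalPDF (-x) = stdNormalPDF x := by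
  simp [stdNormalPDF]

lemma stdNormalCDF_eq_integral_Ioi (a : ℝ) : stdNormalCDF a = ∫ t in Ioi (-a), stdNormalPDF t := by
  rw [stdNormalCDF, ← integral_comp_neg_Iic]
  simp only [stdNormalPDF_neg]

lemma stdNormalCDF_pos (a : ℝ) : 0 < stdNormalCDF a := by
  rw [stdNormalCDF, stdNormalPDF_eq_gaussianPDFReal, setIntegral_pos_iff_support_of_nonneg_ae
    (ae_of_all _ (gaussianPDFReal_nonneg 0 1)) (integrable_gaussianPDFReal 0 1).integrableOn]
  have hsupp : Function.support (gaussianPDFReal 0 1) = univ :=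
    eq_univ_of_forall fun x => (gaussianPDFReal_pos 0 1 x one_ne_zero).ne'
  simp [hsupp]

lemma gaussianReal_real_Ioi_neg (a : ℝ) : (gaussianReal 0 1).real (Ioi (-a)) = stdNormalCDF a := by
  rw [measureReal_def, gaussianReal_apply_eq_integral 0 one_ne_zero,
    ← stdNormalPDF_eq_gaussianPDFReal, ← stdNormalCDF_eq_integral_Ioi,
    ENNReal.toReal_ofReal (stdNormalCDF_pos a).le]

lemma hasDerivAt_neg_stdNormalPDF (x : ℝ) :
    HasDerivAt (fun t => -stdNormalPDF t) (stdNormalPDF x * x) x := by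
  have hexp : HasDerivAt (fun t : ℝ => -t ^ 2 / 2) (-x) x := by
    convert! ((hasDerivAt_pow 2 x).neg.div_const 2) using 1
    simp; ring
  convert! (hexp.exp.const_mul (√(2 * π))⁻¹).neg using 1
  simp only [stdNormalPDF]
  ring

lemma tendsto_stdNormalPDF_atTop : Tendsto stdNormalPDF atTop (𝓝 0) := by
  have hsq : Tendsto (fun x : ℝ => x ^ 2 / 2) atTop atTop :=
    (tendsto_pow_atTop two_ne_zero).atTop_div_const two_pos
  have h := (tendsto_exp_neg_atTop_nhds_zero.comp hsq).const_mul (√(2 * π))⁻¹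
  rw [mul_zero] at h
  refine h.congr fun x => ?_
  simp [stdNormalPDF, neg_div]

lemma integrable_stdNormalPDF_mul_id : Integrable fun x => stdNormalPDF x * x := by
  have h := (integrable_mul_exp_neg_mul_sq (b := 1 / 2) (by norm_num)).const_mul (√(2 * π))⁻¹
  refine h.congr (ae_of_all _ fun x => ?_)
  simp only [stdNormalPDF]
  rw [show -(1 / 2) * x ^ 2 = -x ^ 2 / 2 by ring]
  ring

lemma setIntegral_id_gaussianReal_Ioi_neg (a : ℝ) :
    ∫ x in Ioi (-a), x ∂(gaussianReal 0 1) = stdNormalPDF a := by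
  have hFTC := integral_Ioi_of_hasDerivAt_of_tendsto' (a := -a)
    (fun x _ => hasDerivAt_neg_stdNormalPDF x)
    integrable_stdNormalPDF_mul_id.integrableOn tendsto_stdNormalPDF_atTop.neg
  rw [← integral_indicator measurableSet_Ioi, integral_gaussianReal_eq_integral_smul one_ne_zero,
    ← stdNormalPDF_eq_gaussianPDFReal]
  simp_rw [smul_eq_mul, ← indicator_mul_right (Ioi (-a)) stdNormalPDF (fun x => x)]
  rw [integral_indicator measurableSet_Ioi, hFTC, stdNormalPDF_neg]
  ring

section

variable {Ω : Type*} [MeasurableSpace Ω] {P : Measure Ω}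

/-- The integral of a random variable over an independent event factorizes. -/
lemma ProbabilityTheory.IndepFun.setIntegral_preimage {α : Type*} [MeasurableSpace α]
    {X : Ω → ℝ} {Y : Ω → α} (hXY : IndepFun X Y P) (hX : AEStronglyMeasurable X P)
    (hY : Measurable Y) {S : Set α} (hS : MeasurableSet S) :
    ∫ ω in Y ⁻¹' S, X ω ∂P = P.real (Y ⁻¹' S) * ∫ ω, X ω ∂P := by
  have hind : Measurable (S.indicator (1 : α → ℝ)) := measurable_one.indicator hS
  have h := (hXY.comp measurable_id hind).integral_fun_mul_eq_mul_integral hX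
    (hind.comp hY).aestronglyMeasurable
  have hprod : ∀ ω, (id ∘ X) ω * (S.indicator (1 : α → ℝ) ∘ Y) ω
      = (Y ⁻¹' S).indicator X ω := fun ω => by
    by_cases hω : Y ω ∈ S <;> simp [indicator, hω]
  have hone : (S.indicator (1 : α → ℝ) ∘ Y) = (Y ⁻¹' S).indicator 1 := rfl
  simp_rw [hprod] at h
  rw [integral_indicator (hY hS), hone, integral_indicator_one (hY hS)] at h
  rw [h, mul_comm]
  rfl

variable {ε v : Ω → ℝ}

lemma measureReal_lt_of_map_eq_gaussianReal (hε : Measurable ε)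
    (hlaw : P.map ε = gaussianReal 0 1) (a : ℝ) :
    P.real (ε ⁻¹' Ioi (-a)) = stdNormalCDF a := by
  rw [← map_measureReal_apply hε measurableSet_Ioi, hlaw, gaussianReal_real_Ioi_neg]

lemma integrable_of_map_eq_gaussianReal (hε : Measurable ε) (hlaw : P.map ε = gaussianReal 0 1) :
    Integrable ε P := by
  have h : Integrable id (P.map ε) := by
    rw [hlaw]
    exact memLp_one_iff_integrable.mp (memLp_id_gaussianReal 1)
  exact h.comp_measurable hε

/-- The Heckman selection integral: the outcome `c + ρ ε + v` integrated over the selection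
event `ε > -a`. -/
lemma setIntegral_outcome_of_selection [IsProbabilityMeasure P] (hε : Measurable ε)
    (hlaw : P.map ε = gaussianReal 0 1) (hv : Integrable v P) (hv0 : ∫ ω, v ω ∂P = 0)
    (hindep : IndepFun ε v P) (c ρ a : ℝ) :
    ∫ ω in ε ⁻¹' Ioi (-a), (c + ρ * ε ω + v ω) ∂P = c * stdNormalCDF a + ρ * stdNormalPDF a := by
  have hεint := integrable_of_map_eq_gaussianReal hε hlaw
  have hε_integral : ∫ ω in ε ⁻¹' Ioi (-a), ε ω ∂P = stdNormalPDF a := by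
    rw [← setIntegral_id_gaussianReal_Ioi_neg, ← hlaw]
    exact (setIntegral_map measurableSet_Ioi aestronglyMeasurable_id hε.aemeasurable).symm
  have hsum : Integrable (fun ω => c + ρ * ε ω) P := (integrable_const c).add (hεint.const_mul ρ)
  rw [integral_add hsum.integrableOn hv.integrableOn,
    integral_add (integrable_const c) (hεint.const_mul ρ).integrableOn, integral_const_mul,
    hε_integral, hindep.symm.setIntegral_preimage hv.1 hε measurableSet_Ioi, hv0,
    setIntegral_const, measureReal_lt_of_map_eq_gaussianReal hε hlaw, smul_eq_mul]
  ring

/-- Selection of an independent second individual only rescales the selection integral. -/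
lemma setIntegral_outcome_of_joint_selection [IsProbabilityMeasure P] {η w : Ω → ℝ}
    (hε : Measurable ε) (hlaw : P.map ε = gaussianReal 0 1) (hv : Integrable v P)
    (hv0 : ∫ ω, v ω ∂P = 0) (hindep : IndepFun ε v P)
    (hη : Measurable η) (hηlaw : P.map η = gaussianReal 0 1)
    (hpair : IndepFun (fun ω => (ε ω, v ω)) (fun ω => (η ω, w ω)) P) (c ρ a b : ℝ) :
    ∫ ω in ε ⁻¹' Ioi (-a) ∩ η ⁻¹' Ioi (-b), (c + ρ * ε ω + v ω) ∂P
      = stdNormalCDF b * (c * stdNormalCDF a + ρ * stdNormalPDF a) := by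
  have hA : MeasurableSet (ε ⁻¹' Ioi (-a)) := hε measurableSet_Ioi
  have hg : Measurable ((Prod.fst ⁻¹' Ioi (-a)).indicator
      fun q : ℝ × ℝ => c + ρ * q.1 + q.2) :=
    Measurable.indicator (by fun_prop) (measurable_fst measurableSet_Ioi)
  have hY : Integrable (fun ω => c + ρ * ε ω + v ω) P :=
    ((integrable_const c).add ((integrable_of_map_eq_gaussianReal hε hlaw).const_mul ρ)).add hv
  have hfactor : IndepFun ((ε ⁻¹' Ioi (-a)).indicator fun ω => c + ρ * ε ω + v ω) η P :=
    hpair.comp hg measurable_fst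
  rw [inter_comm, ← setIntegral_indicator hA,
    hfactor.setIntegral_preimage (hY.1.indicator hA) hη measurableSet_Ioi,
    integral_indicator hA, setIntegral_outcome_of_selection hε hlaw hv hv0 hindep,
    measureReal_lt_of_map_eq_gaussianReal hη hηlaw]

end

/-- Identification via spatial differencing (Theorem 1). With common sub-location plus location
effects `γ` (outcome) and `θ` (selection) for both individuals, standard normal selection errors
`ε₁ᵢ, ε₁ₖ`, mean-zero integrable outcome errors `vᵢ, vₖ`, with `vᵢ ⊥ ε₁ᵢ`, `vₖ ⊥ ε₁ₖ`, and
`(ε₁ᵢ, vᵢ) ⊥ (ε₁ₖ, vₖ)`, outcomes `yᵢ = ⟨xᵢ, δ⟩ + γ + ρ ε₁ᵢ + vᵢ` (resp. `k`), and selection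
events `Aᵢ = {ε₁ᵢ > −(⟨zᵢ, β⟩ + θ)}` (resp. `k`), if the Mills-ratio increments agree
(Assumption I3(ii)), then
`E[yᵢ − yₖ | Aᵢ ∩ Aₖ] = ⟨xᵢ − xₖ, δ⟩ + ρ (λ(⟨zᵢ, β⟩) − λ(⟨zₖ, β⟩))`. -/
theorem spatial_differencing_identification (Ω : Type*) [MeasurableSpace Ω] (P : Measure Ω)
    [IsProbabilityMeasure P] (p k : ℕ)
    (xi xk : Fin p → ℝ) (zi zk : Fin k → ℝ) (δ : Fin p → ℝ) (β : Fin k → ℝ)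
    (ρ γ θ : ℝ) (ε1i ε1k vi vk : Ω → ℝ)
    (hε1i_m : Measurable ε1i) (hε1k_m : Measurable ε1k)
    (hε1i : Measure.map ε1i P = gaussianReal 0 1)
    (hε1k : Measure.map ε1k P = gaussianReal 0 1)
    (hvi : Integrable vi P) (hvk : Integrable vk P)
    (hvi0 : ∫ ω, vi ω ∂P = 0) (hvk0 : ∫ ω, vk ω ∂P = 0)
    (hindep_i : IndepFun ε1i vi P) (hindep_k : IndepFun ε1k vk P)
    (hindep_ik : IndepFun (fun ω => (ε1i ω, vi ω)) (fun ω => (ε1k ω, vk ω)) P)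
    (hmills : invMills ((∑ j, zi j * β j) + θ) - invMills (∑ j, zi j * β j)
      = invMills ((∑ j, zk j * β j) + θ) - invMills (∑ j, zk j * β j)) :
    condExpEvent P
        (fun ω => ((∑ j, xi j * δ j) + γ + ρ * ε1i ω + vi ω)
          - ((∑ j, xk j * δ j) + γ + ρ * ε1k ω + vk ω))
        ({ω | ε1i ω > -((∑ j, zi j * β j) + θ)} ∩ {ω | ε1k ω > -((∑ j, zk j * β j) + θ)})
      = (∑ j, (xi j - xk j) * δ j)
          + ρ * (invMills (∑ j, zi j * β j) - invMills (∑ j, zk j * β j)) := by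
  set a := (∑ j, zi j * β j) + θ
  set b := (∑ j, zk j * β j) + θ
  have hset : ({ω | ε1i ω > -a} ∩ {ω | ε1k ω > -b}) = ε1i ⁻¹' Ioi (-a) ∩ ε1k ⁻¹' Ioi (-b) := rfl
  have hprob : P.real (ε1i ⁻¹' Ioi (-a) ∩ ε1k ⁻¹' Ioi (-b)) = stdNormalCDF a * stdNormalCDF b := by
    have hε : IndepFun ε1i ε1k P := hindep_ik.comp measurable_fst measurable_fst
    rw [measureReal_def, hε.measure_inter_preimage_eq_mul _ _ measurableSet_Ioi measurableSet_Ioi,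
      ENNReal.toReal_mul, ← measureReal_def, ← measureReal_def,
      measureReal_lt_of_map_eq_gaussianReal hε1i_m hε1i,
      measureReal_lt_of_map_eq_gaussianReal hε1k_m hε1k]
  have hinti : Integrable (fun ω => (∑ j, xi j * δ j) + γ + ρ * ε1i ω + vi ω) P :=
    ((integrable_const _).add
      ((integrable_of_map_eq_gaussianReal hε1i_m hε1i).const_mul ρ)).add hvi
  have hintk : Integrable (fun ω => (∑ j, xk j * δ j) + γ + ρ * ε1k ω + vk ω) P :=
    ((integrable_const _).add
      ((integrable_of_map_eq_gaussianReal hε1k_m hε1k).const_mul ρ)).add hvk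
  have hi := setIntegral_outcome_of_joint_selection hε1i_m hε1i hvi hvi0 hindep_i hε1k_m hε1k
    hindep_ik ((∑ j, xi j * δ j) + γ) ρ a b
  have hk := setIntegral_outcome_of_joint_selection hε1k_m hε1k hvk hvk0 hindep_k hε1i_m hε1i
    hindep_ik.symm ((∑ j, xk j * δ j) + γ) ρ b a
  rw [inter_comm] at hk
  have hx : ∑ j, (xi j - xk j) * δ j = (∑ j, xi j * δ j) - ∑ j, xk j * δ j := by
    simp only [sub_mul, Finset.sum_sub_distrib]
  have hincr : invMills (∑ j, zi j * β j) - invMills (∑ j, zk j * β j)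
      = invMills a - invMills b := by linarith
  have ha := (stdNormalCDF_pos a).ne'
  have hb := (stdNormalCDF_pos b).ne'
  rw [condExpEvent, hset, integral_sub hinti.integrableOn hintk.integrableOn, hi, hk,
    ← measureReal_def, hprob, hx, hincr, invMills, invMills]
  field_simp
  ring
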